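/- Let g ∈ F be an element whose associated action on binary words fixes the word 1ⁿ (the word consisting of n letters 1) for every n ∈ ℕ. Then there exist n ∈ ℕ and k ∈ ℤ such that π(g|_{1ⁿ}) = π(b)^k in Ĝ. -/

import Mathlib

noncomputable section

/-- The action of `Equiv.Perm X` on `X → G` by permuting coordinates. -/
def permAut (X G : Type) [Group G] : Equiv.Perm X →* MulAut (X → G) where
  toFun σ :=
  { toFun := fun f => f ∘ ⇑σ⁻¹
    invFun := fun f => f ∘ ⇑σ
    left_inv := fun f => by funext x; simp
    right_inv := fun f => by funext x; simp
    map_mul' := fun f g => rfl }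
  map_one' := by ext f x; simp
  map_mul' := fun σ τ => by
    ext f x
    simp [Function.comp, mul_inv_rev]

/-- The wreath product `G ≀ C₂` with base alphabet `Bool`. -/
abbrev Wr (G : Type) [Group G] := (Bool → G) ⋊[permAut Bool G] Equiv.Perm Bool

/-- `pair g₀ g₁` is the element `⟨g₀, g₁⟩` of the base group. -/
def pair {G : Type} [Group G] (g₀ g₁ : G) : Bool → G := fun x => bif x then g₁ else g₀

/-- The nontrivial element of `Sym({0,1})`. -/
def σswap : Equiv.Perm Bool := Equiv.swap false true

namespace Obstr

/-- The free group on two generators `a`, `b`. -/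
abbrev F := FreeGroup Bool

def ag : F := FreeGroup.of false
def bg : F := FreeGroup.of true

/-- The wreath recursion `Φ(a) = ⟨1,1⟩σ`, `Φ(b) = ⟨b⁻¹a⁻¹, b⟩`. -/
def Phi : F →* Wr F := FreeGroup.lift fun x =>
  if x then ⟨pair (bg⁻¹ * ag⁻¹) bg, 1⟩ else ⟨pair 1 1, σswap⟩

/-- The section `g|ₓ`. -/
def sec (g : F) (x : Bool) : F := (Phi g).left x

/-- `Φ(g)` is inactive. -/
def inactive (g : F) : Prop := (Phi g).right = 1

/-- The commutator `[x,y] = x⁻¹y⁻¹xy`. -/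
def comm (x y : F) : F := x⁻¹ * y⁻¹ * x * y

/-- The relators `{a², (ab)⁴} ∪ {[b⁴, w⁻¹b⁴w] : w ∈ F}`. -/
def rels : Set F :=
  {ag ^ 2, (ag * bg) ^ 4} ∪ {x : F | ∃ w : F, x = comm (bg ^ 4) (w⁻¹ * bg ^ 4 * w)}

/-- `N`, the normal closure of the relators. -/
def NN : Subgroup F := Subgroup.normalClosure rels

instance : NN.Normal := Subgroup.normalClosure_normal

/-- The quotient group `Ĝ = F/N`. -/
abbrev Ghat := F ⧸ NN

/-- The quotient homomorphism `π : F → Ĝ`. -/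
def pi : F →* Ghat := QuotientGroup.mk' NN

end Obstr

namespace Obstr

/-- Sections along finite binary words: `g|_∅ = g`, `g|_{xv} = (g|ₓ)|ᵥ`. -/
def secw : F → List Bool → F
  | g, [] => g
  | g, x :: v => secw (sec g x) v

/-- The associated action of `F` on finite binary words. -/
def act : F → List Bool → List Bool
  | _, [] => []
  | g, x :: v => (Phi g).right x :: act (sec g x) v

end Obstr

namespace Obstr

def rr : F →* Equiv.Perm Bool := SemidirectProduct.rightHom.comp Phi

lemma rr_def (g : F) : rr g = (Phi g).right := rfl

lemma sec_mul (g h : F) (x : Bool) : sec (g * h) x = sec g x * sec h ((rr g)⁻¹ x) := by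
  simp only [sec, map_mul, SemidirectProduct.mul_left, Pi.mul_apply, rr_def]
  rfl

lemma sec_one (x : Bool) : sec 1 x = 1 := by simp [sec]

lemma sec_inv (g : F) (x : Bool) : sec g⁻¹ x = (sec g (rr g x))⁻¹ := by
  have := sec_mul g g⁻¹ (rr g x)
  rw [mul_inv_cancel, sec_one] at this
  have e : (rr g)⁻¹ (rr g x) = x := (rr g).symm_apply_apply x
  rw [e] at this
  exact (inv_eq_of_mul_eq_one_right this.symm).symm

lemma sec_mul' {g : F} (hg : rr g = 1) (h : F) (x : Bool) :
    sec (g * h) x = sec g x * sec h x := by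
  rw [sec_mul, hg]; simp

lemma sec_inv' {g : F} (hg : rr g = 1) (x : Bool) : sec g⁻¹ x = (sec g x)⁻¹ := by
  rw [sec_inv, hg]; simp

lemma perm_cases (p : Equiv.Perm Bool) : p = 1 ∨ p = σswap := by
  revert p; unfold σswap; decide

lemma rr_a : rr ag = σswap := by simp [rr, ag, Phi]
lemma rr_b : rr bg = 1 := by simp [rr, bg, Phi]
lemma sec_a (x : Bool) : sec ag x = 1 := by cases x <;> simp [sec, ag, Phi, pair]
lemma sec_b_true : sec bg true = bg := by
  simp only [sec, Phi]; conv_lhs => rw [bg]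
  simp [pair, bg]
lemma sec_b_false : sec bg false = bg⁻¹ * ag⁻¹ := by
  simp only [sec, Phi]; conv_lhs => rw [bg]
  simp [pair, bg]

/-- Inactive elements. -/
def KK : Subgroup F := rr.ker

lemma mem_KK {g : F} : g ∈ KK ↔ rr g = 1 := Iff.rfl

def sK (x : Bool) : KK →* F where
  toFun g := sec g x
  map_one' := sec_one x
  map_mul' g h := sec_mul' g.2 h x

lemma rr_zpow {g : F} (hg : rr g = 1) (k : ℤ) : rr (g ^ k) = 1 := by simp [hg]
lemma rr_pow {g : F} (hg : rr g = 1) (k : ℕ) : rr (g ^ k) = 1 := by simp [hg]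

lemma sec_zpow {g : F} (hg : rr g = 1) (k : ℤ) (x : Bool) : sec (g ^ k) x = sec g x ^ k :=
  map_zpow (sK x) ⟨g, hg⟩ k

lemma sec_pow {g : F} (hg : rr g = 1) (k : ℕ) (x : Bool) : sec (g ^ k) x = sec g x ^ k :=
  map_pow (sK x) ⟨g, hg⟩ k

lemma swap_true : σswap true = false := by decide
lemma swap_false : σswap false = true := by decide
lemma swap_inv : σswap⁻¹ = σswap := by decide
lemma swap_mul : σswap * σswap = 1 := by decide

/-- Section of a conjugate. -/
lemma sec_conj {g : F} (hg : rr g = 1) (w : F) (x : Bool) :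
    sec (w * g * w⁻¹) x = sec w x * sec g ((rr w)⁻¹ x) * (sec w x)⁻¹ := by
  rw [mul_assoc, sec_mul, sec_mul' hg, sec_inv]
  simp [mul_assoc]

lemma rr_conj {g : F} (hg : rr g = 1) (w : F) : rr (w * g * w⁻¹) = 1 := by
  simp [hg]

/-- Elements inactive with sections in `L`. -/
def LL (L : Subgroup F) : Subgroup F where
  carrier := {g | rr g = 1 ∧ ∀ x, sec g x ∈ L}
  one_mem' := ⟨map_one _, fun x => by rw [sec_one]; exact L.one_mem⟩
  mul_mem' := by
    rintro g h ⟨h1, h2⟩ ⟨h3, h4⟩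
    refine ⟨by simp [h1, h3], fun x => ?_⟩
    rw [sec_mul' h1]; exact L.mul_mem (h2 x) (h4 x)
  inv_mem' := by
    rintro g ⟨h1, h2⟩
    refine ⟨by simp [h1], fun x => ?_⟩
    rw [sec_inv' h1]; exact L.inv_mem (h2 x)

instance (L : Subgroup F) [L.Normal] : (LL L).Normal where
  conj_mem := by
    rintro g ⟨h1, h2⟩ w
    refine ⟨rr_conj h1 w, fun x => ?_⟩
    rw [sec_conj h1]
    exact Subgroup.Normal.conj_mem inferInstance _ (h2 _) _

lemma a2_mem (L : Subgroup F) : ag ^ 2 ∈ LL L := by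
  refine ⟨by simp [rr_a, pow_two, swap_mul], fun x => ?_⟩
  rw [pow_two, sec_mul, sec_a, sec_a]; simp

lemma ab_rr : rr ((ag * bg) ^ 2) = 1 := by simp [pow_two, rr_a, rr_b, swap_mul]

lemma ab4_mem (L : Subgroup F) [L.Normal] (h : ag ^ 2 ∈ L) : (ag * bg) ^ 4 ∈ LL L := by
  have e : (ag * bg) ^ 4 = ((ag * bg) ^ 2) ^ 2 := by rw [← pow_mul]
  rw [e]
  refine ⟨rr_pow ab_rr _, fun x => ?_⟩
  rw [sec_pow ab_rr]
  have h1 : sec ((ag * bg) ^ 2) x = ag⁻¹ ∨ sec ((ag * bg) ^ 2) x = bg⁻¹ * ag⁻¹ * bg⁻¹⁻¹ := by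
    cases x <;>
    simp [pow_two, sec_mul, sec_a, rr_a, rr_b, swap_inv, swap_true, swap_false, sec_b_true,
      sec_b_false]
  rcases h1 with h1 | h1
  · rw [h1, inv_pow]; exact L.inv_mem h
  · rw [h1, conj_pow, inv_pow]
    exact Subgroup.Normal.conj_mem inferInstance _ (L.inv_mem h) _

lemma rr_b4 : rr (bg ^ 4) = 1 := rr_pow rr_b 4
lemma sec_b4_true : sec (bg ^ 4) true = bg ^ 4 := by rw [sec_pow rr_b, sec_b_true]
lemma sec_b4_false : sec (bg ^ 4) false = ((ag * bg) ^ 4)⁻¹ := by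
  rw [sec_pow rr_b, sec_b_false, ← mul_inv_rev, inv_pow]

lemma a2_NN : ag ^ 2 ∈ NN := Subgroup.subset_normalClosure (by simp [rels])
lemma ab4_NN : (ag * bg) ^ 4 ∈ NN := Subgroup.subset_normalClosure (by simp [rels])
lemma comm_NN (w : F) : comm (bg ^ 4) (w⁻¹ * bg ^ 4 * w) ∈ NN :=
  Subgroup.subset_normalClosure (Or.inr ⟨w, rfl⟩)

lemma mem_NN {g : F} : g ∈ NN ↔ pi g = 1 := (QuotientGroup.eq_one_iff g).symm

lemma comm_LL (w : F) : comm (bg ^ 4) (w⁻¹ * bg ^ 4 * w) ∈ LL NN := by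
  have hc : rr (w⁻¹ * bg ^ 4 * w) = 1 := by simpa using rr_conj rr_b4 w⁻¹
  have hb' : rr (bg ^ 4)⁻¹ = 1 := by rw [map_inv, rr_b4, inv_one]
  have hc' : rr (w⁻¹ * bg ^ 4 * w)⁻¹ = 1 := by rw [map_inv, hc, inv_one]
  have hs : ∀ x, sec (w⁻¹ * bg ^ 4 * w) x
      = sec w⁻¹ x * sec (bg ^ 4) (rr w x) * (sec w⁻¹ x)⁻¹ := fun x => by
    simpa using sec_conj rr_b4 w⁻¹ x
  refine ⟨?_, fun x => ?_⟩
  · unfold comm; simp only [map_mul, hb', hc', rr_b4, hc, map_inv]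
    simp
  · have e : sec (comm (bg ^ 4) (w⁻¹ * bg ^ 4 * w)) x
        = comm (sec (bg ^ 4) x) (sec (w⁻¹ * bg ^ 4 * w) x) := by
      unfold comm
      rw [mul_assoc, mul_assoc, sec_mul' hb', sec_mul' hc', sec_mul' rr_b4, sec_inv' rr_b4,
        sec_inv' hc]
      group
    rw [e, hs]
    have h4 : pi ((ag * bg) ^ 4) = 1 := mem_NN.1 ab4_NN
    cases x
    · rw [mem_NN, sec_b4_false]
      simp only [comm, map_mul, map_inv, h4]
      group
    · rcases perm_cases (rr w) with h | h
      · rw [h]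
        have := comm_NN (sec w⁻¹ true)⁻¹
        simpa [sec_b4_true] using this
      · rw [h, swap_true, mem_NN, sec_b4_false]
        simp only [comm, map_mul, map_inv, h4]
        simp

lemma NN_le : NN ≤ LL NN := by
  refine Subgroup.normalClosure_le_normal ?_
  rintro g (hg | ⟨w, rfl⟩)
  · rcases hg with rfl | hg
    · exact a2_mem _
    · rw [Set.mem_singleton_iff] at hg
      rw [hg]; exact ab4_mem _ a2_NN
  · exact comm_LL w

/-! ### The Euclidean quotient -/

def MM : Subgroup F := Subgroup.normalClosure {ag ^ 2, (ag * bg) ^ 4, bg ^ 4}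
instance : MM.Normal := Subgroup.normalClosure_normal

lemma a2_MM : ag ^ 2 ∈ MM := Subgroup.subset_normalClosure (by simp)
lemma ab4_MM : (ag * bg) ^ 4 ∈ MM := Subgroup.subset_normalClosure (by simp)
lemma b4_MM : bg ^ 4 ∈ MM := Subgroup.subset_normalClosure (by simp)

lemma MM_le : MM ≤ LL MM := by
  refine Subgroup.normalClosure_le_normal ?_
  rintro g (rfl | rfl | rfl)
  · exact a2_mem _
  · exact ab4_mem _ a2_MM
  · refine ⟨rr_b4, fun x => ?_⟩
    cases x
    · rw [sec_b4_false]; exact MM.inv_mem ab4_MM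
    · rw [sec_b4_true]; exact b4_MM

def q : F →* F ⧸ MM := QuotientGroup.mk' MM
lemma mem_MM {g : F} : g ∈ MM ↔ q g = 1 := (QuotientGroup.eq_one_iff g).symm

lemma q_eq {g h : F} (e : q g = q h) : ∃ m ∈ MM, g = h * m :=
  ⟨h⁻¹ * g, by rw [mem_MM, map_mul, map_inv, e, inv_mul_cancel], by group⟩

lemma q_sec {g h : F} (e : q g = q h) : rr g = rr h ∧ ∀ x, q (sec g x) = q (sec h x) := by
  obtain ⟨m, hm, rfl⟩ := q_eq e
  obtain ⟨h1, h2⟩ := MM_le hm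
  refine ⟨by simp [h1], fun x => ?_⟩
  rw [sec_mul, map_mul, mem_MM.1 (h2 _), mul_one]

def xg : F := ag * bg ^ 2
def yg : F := bg⁻¹ * xg * bg

section rel
variable {G : Type*} [Group G] {a b : G}

lemma rel_binv (hb : b ^ 4 = 1) : b ^ 2 = b⁻¹ * b⁻¹ := by
  have : b ^ 2 * b ^ 2 = 1 := by rw [← pow_add]; exact hb
  rw [eq_inv_of_mul_eq_one_left this]; group

lemma rel_ainv (ha : a ^ 2 = 1) : a⁻¹ = a := inv_eq_of_mul_eq_one_left (by rw [← pow_two, ha])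

lemma rel_ab (ha : a ^ 2 = 1) (h : (a * b) ^ 4 = 1) : a * b * a * b = b⁻¹ * a * b⁻¹ * a := by
  have e : (a * b * a * b) * (a * b * a * b) = 1 := by rw [← h]; simp [pow_succ, mul_assoc]
  rw [eq_inv_of_mul_eq_one_left e]
  simp [mul_assoc, rel_ainv ha]

lemma rel_comm (ha : a ^ 2 = 1) (hb : b ^ 4 = 1) (h : (a * b) ^ 4 = 1) :
    (a * b ^ 2) * (b⁻¹ * (a * b ^ 2) * b) = (b⁻¹ * (a * b ^ 2) * b) * (a * b ^ 2) := by
  have e1 : (a * b ^ 2) * (b⁻¹ * (a * b ^ 2) * b) = a * b * a * b * b ^ 2 := by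
    simp [pow_two, mul_assoc]
  have e2 : (b⁻¹ * (a * b ^ 2) * b) * (a * b ^ 2) = b⁻¹ * a * b⁻¹ * a * b ^ 2 := by
    rw [rel_binv hb]; simp [mul_assoc]
  rw [e1, e2, rel_ab ha h]

lemma rel_inv (ha : a ^ 2 = 1) (hb : b ^ 4 = 1) :
    b ^ 2 * (a * b ^ 2) = (a * b ^ 2)⁻¹ * b ^ 2 := by
  rw [mul_inv_rev, rel_ainv ha]
  have e : (b ^ 2)⁻¹ = b ^ 2 := by conv_rhs => rw [rel_binv hb, ← mul_inv_rev, ← pow_two]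
  rw [e, mul_assoc]
end rel

lemma qa2 : q ag ^ 2 = 1 := by rw [← map_pow]; exact mem_MM.1 a2_MM
lemma qb4 : q bg ^ 4 = 1 := by rw [← map_pow]; exact mem_MM.1 b4_MM
lemma qab4 : (q ag * q bg) ^ 4 = 1 := by rw [← map_mul, ← map_pow]; exact mem_MM.1 ab4_MM

lemma qxy : Commute (q xg) (q yg) := by
  simp only [xg, yg, map_mul, map_inv, map_pow]
  exact rel_comm qa2 qb4 qab4

lemma qxb : q bg * q yg = q xg * q bg := by
  simp only [yg, map_mul, map_inv]; group
lemma qxb2 : q bg ^ 2 * q xg = (q xg)⁻¹ * q bg ^ 2 := by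
  simp only [xg, map_mul, map_pow]
  exact rel_inv qa2 qb4

lemma qbx : q bg * q xg = (q yg)⁻¹ * q bg := by
  have := qxb2
  have h2 : q bg * (q bg * q xg) = q bg * ((q yg)⁻¹ * q bg) := by
    rw [← mul_assoc, ← pow_two, this, pow_two, ← mul_assoc, ← mul_assoc]
    congr 1
    rw [inv_mul_eq_iff_eq_mul, ← mul_assoc, ← qxb, mul_assoc, mul_inv_cancel, mul_one]
  exact mul_left_cancel h2

lemma form_b_x (k : ℕ) : ∃ p r : ℤ, q bg ^ k * q xg = q xg ^ p * q yg ^ r * q bg ^ k := by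
  have key : ∀ p r : ℤ, q bg * (q xg ^ p * q yg ^ r) = q xg ^ r * q yg ^ (-p) * q bg := by
    intro p r
    have h1 : SemiconjBy (q bg) (q xg ^ p) ((q yg)⁻¹ ^ p) := SemiconjBy.zpow_right qbx p
    have h2 : SemiconjBy (q bg) (q yg ^ r) (q xg ^ r) := SemiconjBy.zpow_right qxb r
    have h3 := (h1.mul_right h2).eq
    rw [h3, inv_zpow', ((qxy.zpow_zpow r (-p))).eq]
  induction k with
  | zero => exact ⟨1, 0, by simp⟩
  | succ k ih =>
    obtain ⟨p, r, h⟩ := ih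
    refine ⟨r, -p, ?_⟩
    rw [pow_succ', mul_assoc, h, ← mul_assoc, key, mul_assoc]

lemma form (g : F) : ∃ (p r : ℤ) (k : ℕ), q g = q xg ^ p * q yg ^ r * q bg ^ k := by
  have hx : q ag = q xg * q bg ^ 2 := by
    simp only [xg, map_mul, map_pow]
    rw [mul_assoc, ← pow_add, qb4, mul_one]
  have stepb : ∀ u : F ⧸ MM, (∃ (p r : ℤ) (k : ℕ), u = q xg ^ p * q yg ^ r * q bg ^ k) →
      (∃ (p r : ℤ) (k : ℕ), u * q bg = q xg ^ p * q yg ^ r * q bg ^ k) := by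
    rintro u ⟨p, r, k, rfl⟩
    exact ⟨p, r, k + 1, by rw [pow_succ]; simp only [mul_assoc]⟩
  have stepa : ∀ u : F ⧸ MM, (∃ (p r : ℤ) (k : ℕ), u = q xg ^ p * q yg ^ r * q bg ^ k) →
      (∃ (p r : ℤ) (k : ℕ), u * q ag = q xg ^ p * q yg ^ r * q bg ^ k) := by
    rintro u ⟨p, r, k, rfl⟩
    obtain ⟨p', r', h⟩ := form_b_x k
    refine ⟨p + p', r + r', k + 2, ?_⟩
    rw [hx, ← mul_assoc, mul_assoc _ (q bg ^ k), h, zpow_add, zpow_add, pow_add]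
    have := (qxy.zpow_zpow p' r).eq
    calc _ = q xg ^ p * (q yg ^ r * q xg ^ p') * q yg ^ r' * q bg ^ k * q bg ^ 2 := by
          simp only [mul_assoc]
      _ = _ := by rw [← this]; simp only [mul_assoc]
  have hbi : (q bg)⁻¹ = q bg * q bg * q bg := by
    rw [inv_eq_iff_mul_eq_one, ← qb4]; simp [pow_succ, mul_assoc]
  have hai : (q ag)⁻¹ = q ag := rel_ainv qa2
  have hg : g ∈ Subgroup.closure (Set.range (FreeGroup.of : Bool → F)) := by
    rw [FreeGroup.closure_range_of]; trivial
  induction hg using Subgroup.closure_induction_right with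
  | one => exact ⟨0, 0, 0, by simp⟩
  | mul_right u _ y hy ih =>
    obtain ⟨x, rfl⟩ := hy
    rw [map_mul]
    cases x
    · exact stepa _ ih
    · exact stepb _ ih
  | mul_inv_cancel u _ y hy ih =>
    obtain ⟨x, rfl⟩ := hy
    rw [map_mul, map_inv]
    cases x
    · change ∃ (p r : ℤ) (k : ℕ), q u * (q ag)⁻¹ = _
      rw [hai]; exact stepa _ ih
    · change ∃ (p r : ℤ) (k : ℕ), q u * (q bg)⁻¹ = _
      rw [hbi, ← mul_assoc, ← mul_assoc]
      exact stepb _ (stepb _ (stepb _ ih))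

/-! ### Descent -/

def Fix (g : F) : Prop := ∀ n : ℕ, act g (List.replicate n true) = List.replicate n true

lemma rr_true {g : F} (h : rr g true = true) : rr g = 1 := by
  rcases perm_cases (rr g) with e | e
  · exact e
  · rw [e, swap_true] at h; cases h

lemma act_succ (g : F) (n : ℕ) : act g (List.replicate (n + 1) true) = List.replicate (n + 1) true
    ↔ rr g = 1 ∧ act (sec g true) (List.replicate n true) = List.replicate n true := by
  rw [List.replicate_succ, act, List.cons.injEq]
  constructor
  · rintro ⟨h1, h2⟩; exact ⟨rr_true h1, h2⟩
  · rintro ⟨h1, h2⟩; exact ⟨by rw [← rr_def, h1]; rfl, h2⟩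

lemma Fix.inactive {g : F} (h : Fix g) : rr g = 1 := ((act_succ g 0).1 (h 1)).1
lemma Fix.sec {g : F} (h : Fix g) : Fix (sec g true) := fun n => ((act_succ g n).1 (h (n + 1))).2

lemma rr_x : rr xg = σswap := by simp [xg, rr_a, rr_b]
lemma rr_y : rr yg = σswap := by simp [yg, rr_x, rr_b]
lemma sec_x_true : sec xg true = (bg⁻¹ * ag⁻¹) ^ 2 := by
  rw [xg, sec_mul, sec_a, rr_a, swap_inv, swap_true, sec_pow rr_b, sec_b_false, one_mul]
lemma sec_x_false : sec xg false = bg ^ 2 := by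
  rw [xg, sec_mul, sec_a, rr_a, swap_inv, swap_false, sec_pow rr_b, sec_b_true, one_mul]
lemma sec_y_false : sec yg false = (bg⁻¹ * ag⁻¹)⁻¹ * bg ^ 2 * bg := by
  rw [yg, mul_assoc, sec_mul' (by simp [rr_b]), sec_inv' rr_b, sec_mul, rr_x, swap_inv, swap_false,
    sec_b_false, sec_b_true, sec_x_false, mul_assoc]

lemma rr_xx : rr (xg * xg) = 1 := by rw [map_mul, rr_x, swap_mul]
lemma rr_xy : rr (xg * yg) = 1 := by rw [map_mul, rr_x, rr_y, swap_mul]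

lemma q_xx : q (sec (xg * xg) true) = q xg * q yg := by
  rw [sec_mul, rr_x, swap_inv, swap_true, sec_x_true, sec_x_false, qxy.eq]
  simp only [yg, xg, map_mul, map_inv, map_pow, rel_ainv qa2]
  have h := rel_binv qb4
  calc _ = (q bg)⁻¹ * q ag * ((q bg)⁻¹ * (q bg)⁻¹) * q bg * q ag * q bg ^ 2 := by
        rw [pow_two (_ * _)]; group
    _ = _ := by rw [← h]; simp only [mul_assoc]

lemma q_xy : q (sec (xg * yg) true) = q yg := by
  rw [sec_mul, rr_x, swap_inv, swap_true, sec_x_true, sec_y_false]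
  simp only [yg, xg, map_mul, map_inv, map_pow, rel_ainv qa2]
  rw [pow_two (_ * _)]; group

lemma descent (n : ℕ) : ∀ (p r : ℤ) (k : ℕ) (h : F), p ^ 2 + r ^ 2 ≤ n →
    q h = q xg ^ p * q yg ^ r * q bg ^ k → Fix h → p = 0 ∧ r = 0 := by
  induction n using Nat.strong_induction_on with
  | _ n ih =>
    intro p r k h hn hq hf
    by_contra hne
    have hpos : 0 < p ^ 2 + r ^ 2 := by
      rcases not_and_or.1 hne with h | h <;> positivity
    have e1 : q h = q (xg ^ p * yg ^ r * bg ^ k) := by simp [hq]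
    have hpar : Even (p + r) := by
      have h1 := (q_sec e1).1
      rw [hf.inactive] at h1
      simp only [map_mul, map_zpow, map_pow, rr_x, rr_y, rr_b, one_pow, mul_one] at h1
      rw [← zpow_add] at h1
      by_contra hodd
      rw [Int.not_even_iff_odd] at hodd
      obtain ⟨m, hm⟩ := hodd
      rw [hm, zpow_add, zpow_mul, zpow_ofNat, pow_two, swap_mul, one_zpow, one_mul, zpow_one] at h1
      exact absurd h1 (by decide)
    obtain ⟨m, hm⟩ := hpar
    obtain ⟨s, hs⟩ : ∃ s, s = m - r := ⟨_, rfl⟩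
    have hp : p = s + s + r := by omega
    have e2 : q h = q ((xg * xg) ^ s * (xg * yg) ^ r * bg ^ k) := by
      rw [hq, hp]
      simp only [map_mul, map_zpow, map_pow]
      rw [qxy.mul_zpow, (Commute.refl (q xg)).mul_zpow, zpow_add, zpow_add]
      simp only [mul_assoc]
    have e3 : q (sec h true) = q xg ^ s * q yg ^ (s + r) * q bg ^ k := by
      rw [(q_sec e2).2 true, mul_assoc, sec_mul' (rr_zpow rr_xx s), sec_mul' (rr_zpow rr_xy r),
        sec_zpow rr_xx, sec_zpow rr_xy, sec_pow rr_b, sec_b_true]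
      simp only [map_mul, map_zpow, map_pow, q_xx, q_xy]
      rw [qxy.mul_zpow, zpow_add]
      simp only [mul_assoc]
    have hle : s ^ 2 + (s + r) ^ 2 ≤ ((n - 1 : ℕ) : ℤ) := by
      have h2 : 2 * (s ^ 2 + (s + r) ^ 2) = p ^ 2 + r ^ 2 := by rw [hp]; ring
      have : 1 ≤ n := by omega
      push_cast [this]
      omega
    have := ih (n - 1) (by omega) s (s + r) k (sec h true) hle e3 hf.sec
    apply hne
    omega

lemma fix_form {g : F} (hg : Fix g) : ∃ (k : ℕ), ∃ m ∈ MM, g = bg ^ k * m := by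
  obtain ⟨p, r, k, h⟩ := form g
  obtain ⟨rfl, rfl⟩ := descent (p ^ 2 + r ^ 2).toNat p r k g (by rw [Int.toNat_of_nonneg (by positivity)]) h hg
  obtain ⟨m, hm, e⟩ := q_eq (g := g) (h := bg ^ k) (by simp [h])
  exact ⟨k, m, hm, e⟩

/-! ### The subgroup of good elements -/

inductive Good : F → Prop
  | base (g : F) (k : ℤ) (h : pi g = pi bg ^ k) : Good g
  | step (g : F) (h : rr g = 1) (h' : Good (sec g true)) : Good g

lemma pi_base {g : F} {k : ℤ} (h : pi g = pi bg ^ k) :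
    rr g = 1 ∧ pi (sec g true) = pi bg ^ k := by
  have hm : (bg ^ k)⁻¹ * g ∈ NN := by rw [mem_NN, map_mul, map_inv, h, map_zpow, inv_mul_cancel]
  obtain ⟨m, hm', rfl⟩ : ∃ m ∈ NN, g = bg ^ k * m := ⟨_, hm, by group⟩
  obtain ⟨h1, h2⟩ := NN_le hm'
  refine ⟨by rw [map_mul, rr_zpow rr_b, h1, one_mul], ?_⟩
  rw [sec_mul' (rr_zpow rr_b k), sec_zpow rr_b, sec_b_true, map_mul, mem_NN.1 (h2 _), mul_one,
    map_zpow]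

lemma Good.next {g : F} (h : Good g) : rr g = 1 ∧ Good (sec g true) := by
  cases h with
  | base _ k h => exact ⟨(pi_base h).1, Good.base _ k (pi_base h).2⟩
  | step _ h h' => exact ⟨h, h'⟩

lemma Good.mul {g h : F} (hg : Good g) (hh : Good h) : Good (g * h) := by
  induction hg generalizing h with
  | base g k hg =>
    induction hh generalizing g with
    | base h l hh => exact Good.base _ (k + l) (by rw [map_mul, hg, hh, zpow_add])
    | step h h1 _ ih =>
      obtain ⟨h2, h3⟩ := pi_base hg
      refine Good.step _ (by rw [map_mul, h1, h2, one_mul]) ?_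
      rw [sec_mul' h2]
      exact ih _ h3
  | step g h1 _ ih =>
    refine Good.step _ (by rw [map_mul, h1, hh.next.1, one_mul]) ?_
    rw [sec_mul' h1]
    exact ih hh.next.2

lemma Good.inv {g : F} (hg : Good g) : Good g⁻¹ := by
  induction hg with
  | base g k hg => exact Good.base _ (-k) (by rw [map_inv, hg, zpow_neg])
  | step g h1 _ ih =>
    refine Good.step _ (by rw [map_inv, h1, inv_one]) ?_
    rw [sec_inv' h1]; exact ih

def SS : Subgroup F where
  carrier := {g | Good g}
  one_mem' := Good.base _ 0 (by simp)
  mul_mem' := Good.mul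
  inv_mem' := Good.inv

lemma b4_comm (w : F) : Commute (pi (bg ^ 4)) (pi (w * bg ^ 4 * w⁻¹)) := by
  have h := mem_NN.1 (comm_NN w⁻¹)
  rw [inv_inv] at h
  simp only [comm, map_mul (pi) _ (w * bg ^ 4 * w⁻¹), map_mul (pi) _ (bg ^ 4)] at h
  rw [map_mul, map_inv, map_inv] at h
  have h2 := eq_inv_of_mul_eq_one_left (by simpa only [mul_assoc] using h :
    ((pi (bg ^ 4))⁻¹ * (pi (w * bg ^ 4 * w⁻¹))⁻¹) * (pi (bg ^ 4) * pi (w * bg ^ 4 * w⁻¹)) = 1)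
  rw [← mul_inv_rev, inv_inj] at h2
  exact h2.symm

lemma MM_comm {m : F} (hm : m ∈ MM) : Commute (pi (bg ^ 4)) (pi m) := by
  have : MM ≤ (Subgroup.centralizer {pi (bg ^ 4)}).comap pi := by
    unfold MM Subgroup.normalClosure
    rw [Subgroup.closure_le]
    intro g hg
    rw [Group.mem_conjugatesOfSet_iff] at hg
    obtain ⟨y, hy, hc⟩ := hg
    obtain ⟨w, rfl⟩ := isConj_iff.1 hc
    rw [SetLike.mem_coe, Subgroup.mem_comap, Subgroup.mem_centralizer_singleton_iff]
    rcases hy with rfl | rfl | rfl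
    · have : pi (w * ag ^ 2 * w⁻¹) = 1 :=
        mem_NN.1 (Subgroup.Normal.conj_mem inferInstance _ a2_NN _)
      rw [this]; simp
    · have : pi (w * (ag * bg) ^ 4 * w⁻¹) = 1 :=
        mem_NN.1 (Subgroup.Normal.conj_mem inferInstance _ ab4_NN _)
      rw [this]; simp
    · first | exact (b4_comm w).eq | exact (b4_comm w).eq.symm
  have := this hm
  rw [Subgroup.mem_comap, Subgroup.mem_centralizer_singleton_iff] at this
  first | exact this | exact this.symm

lemma good_not_fix (n : ℕ) : ∀ w : F, act w⁻¹ (List.replicate n true) ≠ List.replicate n true →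
    Good (w * bg ^ 4 * w⁻¹) := by
  induction n with
  | zero => intro w h; exact absurd rfl h
  | succ n ih =>
    intro w h
    refine Good.step _ (rr_conj rr_b4 w) ?_
    rw [sec_conj rr_b4]
    rcases perm_cases (rr w) with e | e
    · rw [e]
      have e' : rr w⁻¹ = 1 := by rw [map_inv, e, inv_one]
      have := ih (sec w true) (by
        intro h'
        apply h
        rw [act_succ, sec_inv' e]
        exact ⟨e', h'⟩)
      simpa [sec_b4_true] using this
    · rw [e, swap_inv, swap_true, sec_b4_false]
      refine Good.base _ 0 ?_
      rw [zpow_zero]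
      exact mem_NN.1 (Subgroup.Normal.conj_mem inferInstance _ (NN.inv_mem ab4_NN) _)

lemma good_conj (w : F) : Good (w * bg ^ 4 * w⁻¹) := by
  by_cases hw : Fix w⁻¹
  · obtain ⟨k, m, hm, e⟩ := fix_form hw
    have e' : w = m⁻¹ * (bg ^ k)⁻¹ := by rw [← inv_inv w, e, mul_inv_rev]
    refine Good.base _ 4 ?_
    have : w * bg ^ 4 * w⁻¹ = m⁻¹ * bg ^ 4 * m := by
      rw [e']; group
    rw [this, map_mul, map_mul, mul_assoc, (MM_comm hm).eq, ← mul_assoc, ← map_mul, inv_mul_cancel]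
    rw [map_one, one_mul, map_pow]; rfl
  · unfold Fix at hw
    push Not at hw
    obtain ⟨n, hn⟩ := hw
    exact good_not_fix n w hn

lemma MM_good : MM ≤ SS := by
  unfold MM Subgroup.normalClosure
  rw [Subgroup.closure_le]
  intro g hg
  rw [Group.mem_conjugatesOfSet_iff] at hg
  obtain ⟨y, hy, hc⟩ := hg
  obtain ⟨w, rfl⟩ := isConj_iff.1 hc
  rcases hy with rfl | rfl | rfl
  · exact Good.base _ 0 (mem_NN.1 (Subgroup.Normal.conj_mem inferInstance _ a2_NN _))
  · exact Good.base _ 0 (mem_NN.1 (Subgroup.Normal.conj_mem inferInstance _ ab4_NN _))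
  · exact good_conj w

lemma Good.final {g : F} (h : Good g) :
    ∃ (n : ℕ) (k : ℤ), pi (secw g (List.replicate n true)) = pi bg ^ k := by
  induction h with
  | base g k h => exact ⟨0, k, h⟩
  | step g _ _ ih =>
    obtain ⟨n, k, h⟩ := ih
    exact ⟨n + 1, k, h⟩

end Obstr

open Obstr in
theorem stmt16 (g : F)
    (hg : ∀ n : ℕ, act g (List.replicate n true) = List.replicate n true) :
    ∃ (n : ℕ) (k : ℤ), pi (secw g (List.replicate n true)) = pi bg ^ k := by
  obtain ⟨k, m, hm, rfl⟩ := fix_form (g := g) hg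
  exact ((Good.base (bg ^ k) k (by simp)).mul (MM_good hm)).final
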